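/- For all N ≥ 1, β > 0 and t ∈ [0,1], E⟨R(σ¹,τ¹)²·R(σ²,τ²)²⟩_t − E⟨R⁻(σ¹,τ¹)²·R(σ²,τ²)²⟩_t ≥ 0, where the Gibbs average ⟨·⟩_t of a function of two pairs (σ¹,τ¹), (σ²,τ²) is taken with respect to the two-fold product of the coupled Gibbs measure G̃_t. -/

import Mathlib

open MeasureTheory ProbabilityTheory Real Finset Filter

noncomputable section

/-- Spin configurations: each of the `N` sites carries a `±1` spin, encoded by a `Bool`. -/
abbrev Config (N : ℕ) := Fin N → Bool

/-- The `±1` value of a spin. -/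
def spin (b : Bool) : ℝ := if b then 1 else -1

/-- The value of the last spin `σ_N` (junk value `0` when `N = 0`). -/
def spinLast {N : ℕ} (σ : Config N) : ℝ :=
  if h : 0 < N then spin (σ ⟨N - 1, Nat.sub_lt h Nat.one_pos⟩) else 0

/-- The Gaussian disorder: i.i.d. standard Gaussians indexed by pairs `(i, j)`
(only the entries with `i < j` are used). -/
def gaussPi (N : ℕ) : Measure (Fin N × Fin N → ℝ) :=
  Measure.pi fun _ => gaussianReal 0 1

instance (N : ℕ) : IsProbabilityMeasure (gaussPi N) := by
  unfold gaussPi; infer_instance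

/-- Three independent copies `g, g', g''` of the disorder. -/
def disM3 (N : ℕ) :
    Measure ((Fin N × Fin N → ℝ) × (Fin N × Fin N → ℝ) × (Fin N × Fin N → ℝ)) :=
  (gaussPi N).prod ((gaussPi N).prod (gaussPi N))

/-- The SK Hamiltonian `H_{N,β}(σ) = (β/√N) ∑_{i<j} g_{ij} σ_i σ_j`. -/
def ham (N : ℕ) (β : ℝ) (g : Fin N × Fin N → ℝ) (σ : Config N) : ℝ :=
  (β / Real.sqrt N) *
    ∑ p ∈ Finset.univ.filter (fun p : Fin N × Fin N => p.1 < p.2),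
      g p * spin (σ p.1) * spin (σ p.2)

/-- The cavity Hamiltonian `H⁻_N(σ) = (β/√N) ∑_{i<j<N} g_{ij} σ_i σ_j` on the first
`N - 1` spins. -/
def hamCav (N : ℕ) (β : ℝ) (g : Fin N × Fin N → ℝ) (σ : Config N) : ℝ :=
  (β / Real.sqrt N) *
    ∑ p ∈ Finset.univ.filter
        (fun p : Fin N × Fin N => p.1 < p.2 ∧ (p.2 : ℕ) < N - 1),
      g p * spin (σ p.1) * spin (σ p.2)

/-- The overlap `R(σ¹,σ²) = (1/N) ∑_{i ≤ N} σ_i¹ σ_i²`. -/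
def ovlp (N : ℕ) (σ τ : Config N) : ℝ := (∑ i, spin (σ i) * spin (τ i)) / N

/-- The truncated overlap `R⁻(σ¹,σ²) = (1/N) ∑_{i ≤ N−1} σ_i¹ σ_i²`. -/
def ovlpm (N : ℕ) (σ τ : Config N) : ℝ :=
  (∑ i ∈ Finset.univ.filter (fun i : Fin N => (i : ℕ) < N - 1),
    spin (σ i) * spin (τ i)) / N

/-- The partition function `Z_N(β)`. -/
def partFun (N : ℕ) (β : ℝ) (g : Fin N × Fin N → ℝ) : ℝ :=
  ∑ σ : Config N, Real.exp (ham N β g σ)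

/-- The free energy `F_N(β) = ln Z_N(β)`. -/
def freeEnergy (N : ℕ) (β : ℝ) (g : Fin N × Fin N → ℝ) : ℝ :=
  Real.log (partFun N β g)

/-- Two-replica Gibbs average `⟨f⟩` for the single SK system. -/
def gibbs2 (N : ℕ) (β : ℝ) (g : Fin N × Fin N → ℝ)
    (f : Config N → Config N → ℝ) : ℝ :=
  (∑ σ : Config N, ∑ τ : Config N,
    f σ τ * Real.exp (ham N β g σ + ham N β g τ)) / (partFun N β g) ^ 2

/-- Disorder expectation of the two-replica Gibbs average. -/
def Egibbs2 (N : ℕ) (β : ℝ) (f : Config N → Config N → ℝ) : ℝ :=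
  ∫ g, gibbs2 N β g f ∂gaussPi N

/-- The interpolated Hamiltonian `√t · H_N + √(1−t) · H'_N`. -/
def hamT (N : ℕ) (β t : ℝ) (g g' : Fin N × Fin N → ℝ) (σ : Config N) : ℝ :=
  Real.sqrt t * ham N β g σ + Real.sqrt (1 - t) * ham N β g' σ

/-- The coupled Gibbs weight `exp(H¹_{N,t}(σ) + H²_{N,t}(τ))`. -/
def wT (N : ℕ) (β t : ℝ) (g g' g'' : Fin N × Fin N → ℝ)
    (ρ : Config N × Config N) : ℝ :=
  Real.exp (hamT N β t g g' ρ.1 + hamT N β t g g'' ρ.2)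

/-- The coupled Gibbs average `⟨f⟩_t` of a function of one pair `(σ, τ)`. -/
def gibbsT (N : ℕ) (β t : ℝ) (g g' g'' : Fin N × Fin N → ℝ)
    (f : Config N × Config N → ℝ) : ℝ :=
  (∑ ρ : Config N × Config N, f ρ * wT N β t g g' g'' ρ) /
    (∑ ρ : Config N × Config N, wT N β t g g' g'' ρ)

/-- The coupled Gibbs average `⟨f⟩_t` of a function of two pairs. -/
def gibbsT2 (N : ℕ) (β t : ℝ) (g g' g'' : Fin N × Fin N → ℝ)
    (f : Config N × Config N → Config N × Config N → ℝ) : ℝ :=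
  (∑ ρ₁ : Config N × Config N, ∑ ρ₂ : Config N × Config N,
    f ρ₁ ρ₂ * wT N β t g g' g'' ρ₁ * wT N β t g g' g'' ρ₂) /
    (∑ ρ : Config N × Config N, wT N β t g g' g'' ρ) ^ 2

/-- Disorder expectation `E⟨f⟩_t` (one pair). -/
def EgibbsT (N : ℕ) (β t : ℝ) (f : Config N × Config N → ℝ) : ℝ :=
  ∫ ω, gibbsT N β t ω.1 ω.2.1 ω.2.2 f ∂disM3 N

/-- Disorder expectation `E⟨f⟩_t` (two pairs). -/
def EgibbsT2 (N : ℕ) (β t : ℝ)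
    (f : Config N × Config N → Config N × Config N → ℝ) : ℝ :=
  ∫ ω, gibbsT2 N β t ω.1 ω.2.1 ω.2.2 f ∂disM3 N

/-- The `s`-dependent cavity field term
`(β/√N) σ_N ∑_{i<N} (√t g_{iN} + √(1−t) g'_{iN}) σ_i`. -/
def cavField (N : ℕ) (β t : ℝ) (g g' : Fin N × Fin N → ℝ) (σ : Config N) : ℝ :=
  if h : 0 < N then
    (β / Real.sqrt N) * spin (σ ⟨N - 1, Nat.sub_lt h Nat.one_pos⟩) *
      ∑ i ∈ Finset.univ.filter (fun i : Fin N => (i : ℕ) < N - 1),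
        (Real.sqrt t * g (i, ⟨N - 1, Nat.sub_lt h Nat.one_pos⟩) +
          Real.sqrt (1 - t) * g' (i, ⟨N - 1, Nat.sub_lt h Nat.one_pos⟩)) * spin (σ i)
  else 0

/-- The cavity-interpolated Hamiltonian `H^1_{N,t,s}` (resp. `H^2_{N,t,s}` with `g''`). -/
def hamTS (N : ℕ) (β t s : ℝ) (g g' : Fin N × Fin N → ℝ) (σ : Config N) : ℝ :=
  Real.sqrt t * hamCav N β g σ + Real.sqrt (1 - t) * hamCav N β g' σ +
    Real.sqrt s * cavField N β t g g' σ

/-- The coupled cavity Gibbs weight `exp(H¹_{N,t,s}(σ) + H²_{N,t,s}(τ))`. -/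
def wTS (N : ℕ) (β t s : ℝ) (g g' g'' : Fin N × Fin N → ℝ)
    (ρ : Config N × Config N) : ℝ :=
  Real.exp (hamTS N β t s g g' ρ.1 + hamTS N β t s g g'' ρ.2)

/-- The coupled cavity Gibbs average `⟨f⟩_{t,s}` of a function of one pair. -/
def gibbsTS1 (N : ℕ) (β t s : ℝ) (g g' g'' : Fin N × Fin N → ℝ)
    (f : Config N × Config N → ℝ) : ℝ :=
  (∑ ρ : Config N × Config N, f ρ * wTS N β t s g g' g'' ρ) /
    (∑ ρ : Config N × Config N, wTS N β t s g g' g'' ρ)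

/-- The coupled cavity Gibbs average `⟨f⟩_{t,s}` of a function of two pairs. -/
def gibbsTS2 (N : ℕ) (β t s : ℝ) (g g' g'' : Fin N × Fin N → ℝ)
    (f : Config N × Config N → Config N × Config N → ℝ) : ℝ :=
  (∑ ρ₁ : Config N × Config N, ∑ ρ₂ : Config N × Config N,
    f ρ₁ ρ₂ * wTS N β t s g g' g'' ρ₁ * wTS N β t s g g' g'' ρ₂) /
    (∑ ρ : Config N × Config N, wTS N β t s g g' g'' ρ) ^ 2

/-- The coupled cavity Gibbs average `⟨f⟩_{t,s}` of a function of `n` pairs. -/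
def gibbsTSn (N : ℕ) (β t s : ℝ) (g g' g'' : Fin N × Fin N → ℝ) {n : ℕ}
    (f : (Fin n → Config N × Config N) → ℝ) : ℝ :=
  (∑ ρ : Fin n → Config N × Config N, f ρ * ∏ l, wTS N β t s g g' g'' (ρ l)) /
    (∑ ρ₀ : Config N × Config N, wTS N β t s g g' g'' ρ₀) ^ n

/-- Disorder expectation `E⟨f⟩_{t,s}` (one pair). -/
def EgibbsTS1 (N : ℕ) (β t s : ℝ) (f : Config N × Config N → ℝ) : ℝ :=
  ∫ ω, gibbsTS1 N β t s ω.1 ω.2.1 ω.2.2 f ∂disM3 N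

/-- Disorder expectation `E⟨f⟩_{t,s}` (two pairs). -/
def EgibbsTS2 (N : ℕ) (β t s : ℝ)
    (f : Config N × Config N → Config N × Config N → ℝ) : ℝ :=
  ∫ ω, gibbsTS2 N β t s ω.1 ω.2.1 ω.2.2 f ∂disM3 N

/-- Disorder expectation `E⟨f⟩_{t,s}` (`n` pairs). -/
def EgibbsTSn (N : ℕ) (β t s : ℝ) {n : ℕ}
    (f : (Fin n → Config N × Config N) → ℝ) : ℝ :=
  ∫ ω, gibbsTSn N β t s ω.1 ω.2.1 ω.2.2 f ∂disM3 N

/-- The covariance kernel `U(ρ, ρ')` of the `s`-part of the coupled cavity Hamiltonians. -/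
def Ufun (N : ℕ) (β t : ℝ) (ρ ρ' : Config N × Config N) : ℝ :=
  β ^ 2 / 2 * (spinLast ρ.1 * spinLast ρ'.1 * ovlpm N ρ.1 ρ'.1 +
      spinLast ρ.2 * spinLast ρ'.2 * ovlpm N ρ.2 ρ'.2) +
    β ^ 2 * t / 2 * (spinLast ρ.1 * spinLast ρ'.2 * ovlpm N ρ.1 ρ'.2 +
      spinLast ρ.2 * spinLast ρ'.1 * ovlpm N ρ.2 ρ'.1)

/-- `ν(β) = −(1/2)·ln(1 − β²) − β²/2`. -/
def nuSK (b : ℝ) : ℝ := -(1 / 2) * Real.log (1 - b ^ 2) - b ^ 2 / 2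

section CoupledGibbs

variable {N : ℕ}

lemma spin_mul_self (b : Bool) : spin b * spin b = 1 := by
  cases b <;> simp [spin]

lemma wT_pos (β t : ℝ) (g g' g'' : Fin N × Fin N → ℝ) (ρ : Config N × Config N) :
    0 < wT N β t g g' g'' ρ := Real.exp_pos _

lemma sum_wT_pos (β t : ℝ) (g g' g'' : Fin N × Fin N → ℝ) :
    0 < ∑ ρ : Config N × Config N, wT N β t g g' g'' ρ :=
  Finset.sum_pos (fun ρ _ => wT_pos β t g g' g'' ρ) Finset.univ_nonempty

/-- The two-pair Gibbs average factorizes on products. -/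
lemma gibbsT2_mul (β t : ℝ) (g g' g'' : Fin N × Fin N → ℝ)
    (f₁ f₂ : Config N × Config N → ℝ) :
    gibbsT2 N β t g g' g'' (fun ρ₁ ρ₂ => f₁ ρ₁ * f₂ ρ₂) =
      gibbsT N β t g g' g'' f₁ * gibbsT N β t g g' g'' f₂ := by
  unfold gibbsT2 gibbsT
  rw [div_mul_div_comm, ← pow_two, Finset.sum_mul_sum]
  congr 1
  refine Finset.sum_congr rfl fun ρ₁ _ => Finset.sum_congr rfl fun ρ₂ _ => ?_
  ring

lemma gibbsT_const (β t : ℝ) (g g' g'' : Fin N × Fin N → ℝ) (c : ℝ) :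
    gibbsT N β t g g' g'' (fun _ => c) = c := by
  unfold gibbsT
  rw [← Finset.mul_sum, mul_div_assoc, div_self (sum_wT_pos β t g g' g'').ne', mul_one]

lemma gibbsT_add (β t : ℝ) (g g' g'' : Fin N × Fin N → ℝ)
    (f₁ f₂ : Config N × Config N → ℝ) :
    gibbsT N β t g g' g'' (fun ρ => f₁ ρ + f₂ ρ) =
      gibbsT N β t g g' g'' f₁ + gibbsT N β t g g' g'' f₂ := by
  simp only [gibbsT, add_mul, Finset.sum_add_distrib, add_div]

lemma gibbsT_const_mul (β t : ℝ) (g g' g'' : Fin N × Fin N → ℝ) (c : ℝ)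
    (f : Config N × Config N → ℝ) :
    gibbsT N β t g g' g'' (fun ρ => c * f ρ) = c * gibbsT N β t g g' g'' f := by
  simp only [gibbsT, mul_assoc, ← Finset.mul_sum, mul_div_assoc]

lemma gibbsT_sum {ι : Type*} (s : Finset ι) (β t : ℝ) (g g' g'' : Fin N × Fin N → ℝ)
    (f : ι → Config N × Config N → ℝ) :
    gibbsT N β t g g' g'' (fun ρ => ∑ i ∈ s, f i ρ) =
      ∑ i ∈ s, gibbsT N β t g g' g'' (f i) := by
  simp only [gibbsT, Finset.sum_mul, ← Finset.sum_div]
  rw [Finset.sum_comm]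

lemma abs_gibbsT_le (β t : ℝ) (g g' g'' : Fin N × Fin N → ℝ)
    (f : Config N × Config N → ℝ) :
    |gibbsT N β t g g' g'' f| ≤ ∑ ρ, |f ρ| := by
  have hZ := sum_wT_pos β t g g' g''
  unfold gibbsT
  rw [abs_div, abs_of_pos hZ, div_le_iff₀ hZ, Finset.mul_sum]
  refine (Finset.abs_sum_le_sum_abs _ _).trans (Finset.sum_le_sum fun ρ _ => ?_)
  rw [abs_mul, abs_of_pos (wT_pos β t g g' g'' ρ)]
  exact mul_le_mul_of_nonneg_right
    (Finset.single_le_sum (f := fun ρ => |f ρ|) (fun _ _ => abs_nonneg _) (Finset.mem_univ ρ))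
    (wT_pos β t g g' g'' ρ).le

lemma measurable_gibbsT (β t : ℝ) (f : Config N × Config N → ℝ) :
    Measurable fun ω : (Fin N × Fin N → ℝ) × (Fin N × Fin N → ℝ) × (Fin N × Fin N → ℝ) =>
      gibbsT N β t ω.1 ω.2.1 ω.2.2 f := by
  unfold gibbsT wT hamT ham
  fun_prop

instance (N : ℕ) : IsProbabilityMeasure (disM3 N) := by
  unfold disM3; infer_instance

lemma integrable_gibbsT (β t : ℝ) (f : Config N × Config N → ℝ) :
    Integrable (fun ω => gibbsT N β t ω.1 ω.2.1 ω.2.2 f) (disM3 N) :=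
  .of_bound (measurable_gibbsT β t f).aestronglyMeasurable (∑ ρ, |f ρ|)
    (.of_forall fun ω => abs_gibbsT_le β t ω.1 ω.2.1 ω.2.2 f)

lemma integrable_gibbsT_mul (β t : ℝ) (f₁ f₂ : Config N × Config N → ℝ) :
    Integrable (fun ω => gibbsT N β t ω.1 ω.2.1 ω.2.2 f₁ * gibbsT N β t ω.1 ω.2.1 ω.2.2 f₂)
      (disM3 N) :=
  (integrable_gibbsT β t f₂).bdd_mul (measurable_gibbsT β t f₁).aestronglyMeasurable
    (.of_forall fun ω => abs_gibbsT_le β t ω.1 ω.2.1 ω.2.2 f₁)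

/-- The action of a site permutation on pairs of sites, arranged so that
the order of the two entries of a pair is preserved. -/
def pairFun (φ : Equiv.Perm (Fin N)) (p : Fin N × Fin N) : Fin N × Fin N :=
  if p.1 < p.2 ↔ φ p.1 < φ p.2 then (φ p.1, φ p.2) else (φ p.2, φ p.1)

lemma pairFun_symm_pairFun (φ : Equiv.Perm (Fin N)) (p : Fin N × Fin N) :
    pairFun φ.symm (pairFun φ p) = p := by
  obtain ⟨i, j⟩ := p
  by_cases h : i < j ↔ φ i < φ j
  · simp [pairFun, h]
  · have hij : i ≠ j := by rintro rfl; simp at h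
    have hne : φ i ≠ φ j := φ.injective.ne hij
    have h' : ¬ (φ j < φ i ↔ j < i) := by grind
    simp [pairFun, h, h']

/-- The permutation of pairs of sites induced by a permutation of sites. -/
def pairPerm (φ : Equiv.Perm (Fin N)) : Equiv.Perm (Fin N × Fin N) where
  toFun := pairFun φ
  invFun := pairFun φ.symm
  left_inv := pairFun_symm_pairFun φ
  right_inv p := by simpa using pairFun_symm_pairFun φ.symm p

lemma ham_comp_pairPerm (β : ℝ) (φ : Equiv.Perm (Fin N)) (g : Fin N × Fin N → ℝ)
    (σ : Config N) :
    ham N β (g ∘ pairPerm φ) (σ ∘ φ) = ham N β g σ := by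
  unfold ham
  congr 1
  refine Finset.sum_equiv (pairPerm φ) ?_ ?_ <;> rintro ⟨i, j⟩
  · simp only [Finset.mem_filter_univ, pairPerm, Equiv.coe_fn_mk, pairFun]
    by_cases h : i < j ↔ φ i < φ j
    · simp [h]
    · have hij : i ≠ j := by rintro rfl; simp at h
      have hne : φ i ≠ φ j := φ.injective.ne hij
      simp only [h, if_false]
      grind
  · intro _
    simp only [Function.comp_apply, pairPerm, Equiv.coe_fn_mk, pairFun]
    split_ifs <;> ring

lemma gibbsT_comp_pairPerm (β t : ℝ) (φ : Equiv.Perm (Fin N))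
    (g g' g'' : Fin N × Fin N → ℝ) (f : Config N × Config N → ℝ) :
    gibbsT N β t (g ∘ pairPerm φ) (g' ∘ pairPerm φ) (g'' ∘ pairPerm φ) f =
      gibbsT N β t g g' g'' (fun ρ => f (ρ.1 ∘ φ, ρ.2 ∘ φ)) := by
  have hw (ρ : Config N × Config N) :
      wT N β t (g ∘ pairPerm φ) (g' ∘ pairPerm φ) (g'' ∘ pairPerm φ) (ρ.1 ∘ φ, ρ.2 ∘ φ) =
        wT N β t g g' g'' ρ := by
    simp only [wT, hamT, ham_comp_pairPerm]
  have hsum (F : Config N × Config N → ℝ) :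
      ∑ ρ : Config N × Config N, F (ρ.1 ∘ φ, ρ.2 ∘ φ) = ∑ ρ, F ρ :=
    ((φ.symm.arrowCongr (Equiv.refl Bool)).prodCongr
      (φ.symm.arrowCongr (Equiv.refl Bool))).sum_comp F
  unfold gibbsT
  rw [← hsum, ← hsum (wT N β t (g ∘ pairPerm φ) (g' ∘ pairPerm φ) (g'' ∘ pairPerm φ))]
  simp only [hw]

lemma measurePreserving_gaussPi_comp (e : Equiv.Perm (Fin N × Fin N)) :
    MeasurePreserving (fun g : Fin N × Fin N → ℝ => g ∘ e) (gaussPi N) (gaussPi N) := by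
  have h := measurePreserving_piCongrLeft
    (fun _ : Fin N × Fin N => gaussianReal 0 1) e.symm
  unfold gaussPi
  convert h using 1
  ext g p
  simp [MeasurableEquiv.coe_piCongrLeft, Equiv.piCongrLeft_apply]

/-- Site exchangeability of the disorder-averaged product of Gibbs averages. -/
lemma integral_gibbsT_mul_perm (β t : ℝ) (φ : Equiv.Perm (Fin N))
    (f₁ f₂ : Config N × Config N → ℝ) :
    ∫ ω, gibbsT N β t ω.1 ω.2.1 ω.2.2 (fun ρ => f₁ (ρ.1 ∘ φ, ρ.2 ∘ φ)) *
        gibbsT N β t ω.1 ω.2.1 ω.2.2 (fun ρ => f₂ (ρ.1 ∘ φ, ρ.2 ∘ φ)) ∂disM3 N =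
      ∫ ω, gibbsT N β t ω.1 ω.2.1 ω.2.2 f₁ * gibbsT N β t ω.1 ω.2.1 ω.2.2 f₂ ∂disM3 N := by
  have h := measurePreserving_gaussPi_comp (pairPerm φ)
  have h₃ := h.prod (h.prod h)
  have hm : Measurable fun ω : (Fin N × Fin N → ℝ) × (Fin N × Fin N → ℝ) ×
      (Fin N × Fin N → ℝ) =>
      gibbsT N β t ω.1 ω.2.1 ω.2.2 f₁ * gibbsT N β t ω.1 ω.2.1 ω.2.2 f₂ :=
    (measurable_gibbsT β t f₁).mul (measurable_gibbsT β t f₂)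
  change _ = ∫ ω, _ ∂((gaussPi N).prod ((gaussPi N).prod (gaussPi N)))
  rw [← h₃.map_eq, integral_map h₃.measurable.aemeasurable hm.aestronglyMeasurable]
  simp only [Prod.map, gibbsT_comp_pairPerm]
  rfl

/-- The Gibbs average of a function of one configuration for the interpolated Hamiltonian. -/
def gibbsMarg (N : ℕ) (β t : ℝ) (g g' : Fin N × Fin N → ℝ) (a : Config N → ℝ) : ℝ :=
  (∑ σ, a σ * Real.exp (hamT N β t g g' σ)) / ∑ σ, Real.exp (hamT N β t g g' σ)

lemma gibbsT_eq_mul_gibbsMarg (β t : ℝ) (g g' g'' : Fin N × Fin N → ℝ)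
    (a b : Config N → ℝ) :
    gibbsT N β t g g' g'' (fun ρ => a ρ.1 * b ρ.2) =
      gibbsMarg N β t g g' a * gibbsMarg N β t g g'' b := by
  unfold gibbsT gibbsMarg wT
  rw [div_mul_div_comm, Finset.sum_mul_sum, Finset.sum_mul_sum, Fintype.sum_prod_type,
    Fintype.sum_prod_type]
  simp only [Real.exp_add, mul_mul_mul_comm]

/-- Conditionally on the shared disorder the two systems are independent copies,
so identical observables are nonnegatively correlated. -/
lemma integral_gibbsT_mul_self_nonneg (β t : ℝ) (a : Config N → ℝ) :
    0 ≤ ∫ ω, gibbsT N β t ω.1 ω.2.1 ω.2.2 (fun ρ => a ρ.1 * a ρ.2) ∂disM3 N := by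
  have hint := integrable_gibbsT β t (fun ρ : Config N × Config N => a ρ.1 * a ρ.2)
  unfold disM3 at hint ⊢
  rw [integral_prod _ hint]
  refine integral_nonneg fun g => ?_
  simp only [gibbsT_eq_mul_gibbsMarg]
  exact (mul_self_nonneg (∫ g', gibbsMarg N β t g g' a ∂gaussPi N)).trans_eq
    (integral_prod_mul _ _).symm

lemma ovlp_sq (σ τ : Config N) :
    ovlp N σ τ ^ 2 = (1 / (N : ℝ) ^ 2) * ∑ p : Fin N × Fin N,
      (spin (σ p.1) * spin (σ p.2)) * (spin (τ p.1) * spin (τ p.2)) := by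
  unfold ovlp
  rw [div_pow, pow_two (∑ i, _), Finset.sum_mul_sum, Fintype.sum_prod_type, div_eq_inv_mul,
    one_div]
  simp only [mul_mul_mul_comm]

lemma one_div_le_integral_gibbsT_ovlp_sq (hN : 1 ≤ N) (β t : ℝ) :
    1 / (N : ℝ) ≤
      ∫ ω, gibbsT N β t ω.1 ω.2.1 ω.2.2 (fun ρ => ovlp N ρ.1 ρ.2 ^ 2) ∂disM3 N := by
  have hN0 : (0 : ℝ) < N := by exact_mod_cast hN
  simp only [ovlp_sq, gibbsT_const_mul, gibbsT_sum]
  rw [integral_const_mul, integral_finsetSum _ fun p _ => integrable_gibbsT β t _]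
  have hdiag (i : Fin N) :
      ∫ ω, gibbsT N β t ω.1 ω.2.1 ω.2.2 (fun ρ =>
        (spin (ρ.1 i) * spin (ρ.1 i)) * (spin (ρ.2 i) * spin (ρ.2 i))) ∂disM3 N = 1 := by
    simp [spin_mul_self, gibbsT_const]
  have hsum : (N : ℝ) ≤ ∑ p : Fin N × Fin N,
      ∫ ω, gibbsT N β t ω.1 ω.2.1 ω.2.2 (fun ρ =>
        (spin (ρ.1 p.1) * spin (ρ.1 p.2)) * (spin (ρ.2 p.1) * spin (ρ.2 p.2))) ∂disM3 N := by
    rw [Fintype.sum_prod_type]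
    calc (N : ℝ) = ∑ _i : Fin N, (1 : ℝ) := by simp
      _ ≤ _ := Finset.sum_le_sum fun i _ => by
        rw [← hdiag i]
        exact Finset.single_le_sum (f := fun j : Fin N =>
          ∫ ω, gibbsT N β t ω.1 ω.2.1 ω.2.2 (fun ρ =>
            (spin (ρ.1 i) * spin (ρ.1 j)) * (spin (ρ.2 i) * spin (ρ.2 j))) ∂disM3 N)
          (fun j _ => integral_gibbsT_mul_self_nonneg β t fun σ => spin (σ i) * spin (σ j))
          (Finset.mem_univ i)
  calc 1 / (N : ℝ) = 1 / (N : ℝ) ^ 2 * N := by field_simp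
    _ ≤ _ := by gcongr

/-- The overlap with the contribution of site `k` removed. -/
def ovlpDel (N : ℕ) (k : Fin N) (σ τ : Config N) : ℝ :=
  ovlp N σ τ - spin (σ k) * spin (τ k) / N

lemma ovlpm_eq_ovlpDel (hN : 1 ≤ N) (σ τ : Config N) :
    ovlpm N σ τ = ovlpDel N ⟨N - 1, Nat.sub_lt hN Nat.one_pos⟩ σ τ := by
  have hf : Finset.univ.filter (fun i : Fin N => (i : ℕ) < N - 1) =
      Finset.univ.erase ⟨N - 1, Nat.sub_lt hN Nat.one_pos⟩ := by
    ext i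
    simp only [Finset.mem_filter_univ, Finset.mem_erase, Finset.mem_univ, and_true, ne_eq,
      Fin.ext_iff]
    omega
  unfold ovlpm ovlpDel ovlp
  rw [hf, ← Finset.add_sum_erase _ _ (Finset.mem_univ ⟨N - 1, Nat.sub_lt hN Nat.one_pos⟩)]
  ring

lemma ovlp_comp_perm (φ : Equiv.Perm (Fin N)) (σ τ : Config N) :
    ovlp N (σ ∘ φ) (τ ∘ φ) = ovlp N σ τ := by
  unfold ovlp
  congr 1
  exact Equiv.sum_comp φ fun i => spin (σ i) * spin (τ i)

lemma ovlpDel_comp_perm (φ : Equiv.Perm (Fin N)) (k : Fin N) (σ τ : Config N) :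
    ovlpDel N k (σ ∘ φ) (τ ∘ φ) = ovlpDel N (φ k) σ τ := by
  simp only [ovlpDel, ovlp_comp_perm, Function.comp_apply]

lemma sum_ovlpDel_sq (hN : 1 ≤ N) (σ τ : Config N) :
    ∑ k, ovlpDel N k σ τ ^ 2 = (N - 2 : ℝ) * ovlp N σ τ ^ 2 + 1 / (N : ℝ) := by
  have hN0 : (N : ℝ) ≠ 0 := by exact_mod_cast (by omega : N ≠ 0)
  have hk (k : Fin N) : ovlpDel N k σ τ ^ 2 =
      ovlp N σ τ ^ 2 + 1 / (N : ℝ) ^ 2 -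
        2 * ovlp N σ τ / N * (spin (σ k) * spin (τ k)) := by
    have h : (spin (σ k) * spin (τ k)) ^ 2 = 1 := by
      rw [pow_two, mul_mul_mul_comm, spin_mul_self, spin_mul_self, one_mul]
    rw [ovlpDel, sub_sq, div_pow, h]
    ring
  have hR : ∑ k, spin (σ k) * spin (τ k) = N * ovlp N σ τ := by
    unfold ovlp
    field_simp
  simp only [hk]
  rw [Finset.sum_sub_distrib, ← Finset.mul_sum, hR]
  simp only [Finset.sum_const, Finset.card_univ, Fintype.card_fin, nsmul_eq_mul]
  field_simp
  ring

lemma integral_gibbsT_ovlpDel_sq (hN : 1 ≤ N) (β t : ℝ) (k : Fin N) :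
    N * ∫ ω, gibbsT N β t ω.1 ω.2.1 ω.2.2 (fun ρ => ovlpDel N k ρ.1 ρ.2 ^ 2) *
        gibbsT N β t ω.1 ω.2.1 ω.2.2 (fun ρ => ovlp N ρ.1 ρ.2 ^ 2) ∂disM3 N =
      (N - 2 : ℝ) * ∫ ω, gibbsT N β t ω.1 ω.2.1 ω.2.2 (fun ρ => ovlp N ρ.1 ρ.2 ^ 2) ^ 2 ∂disM3 N +
        1 / (N : ℝ) *
          ∫ ω, gibbsT N β t ω.1 ω.2.1 ω.2.2 (fun ρ => ovlp N ρ.1 ρ.2 ^ 2) ∂disM3 N := by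
  have hsymm (l : Fin N) :
      ∫ ω, gibbsT N β t ω.1 ω.2.1 ω.2.2 (fun ρ => ovlpDel N l ρ.1 ρ.2 ^ 2) *
        gibbsT N β t ω.1 ω.2.1 ω.2.2 (fun ρ => ovlp N ρ.1 ρ.2 ^ 2) ∂disM3 N =
      ∫ ω, gibbsT N β t ω.1 ω.2.1 ω.2.2 (fun ρ => ovlpDel N k ρ.1 ρ.2 ^ 2) *
        gibbsT N β t ω.1 ω.2.1 ω.2.2 (fun ρ => ovlp N ρ.1 ρ.2 ^ 2) ∂disM3 N := by
    have h := integral_gibbsT_mul_perm β t (Equiv.swap k l)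
      (fun ρ => ovlpDel N k ρ.1 ρ.2 ^ 2) (fun ρ => ovlp N ρ.1 ρ.2 ^ 2)
    simpa only [ovlpDel_comp_perm, ovlp_comp_perm, Equiv.swap_apply_left] using h
  have hsq : Integrable (fun ω =>
      gibbsT N β t ω.1 ω.2.1 ω.2.2 (fun ρ => ovlp N ρ.1 ρ.2 ^ 2) ^ 2) (disM3 N) := by
    simpa only [pow_two (gibbsT _ _ _ _ _ _ _)] using
      integrable_gibbsT_mul β t (fun ρ => ovlp N ρ.1 ρ.2 ^ 2) (fun ρ => ovlp N ρ.1 ρ.2 ^ 2)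
  calc _ = ∑ l : Fin N,
        ∫ ω, gibbsT N β t ω.1 ω.2.1 ω.2.2 (fun ρ => ovlpDel N l ρ.1 ρ.2 ^ 2) *
          gibbsT N β t ω.1 ω.2.1 ω.2.2 (fun ρ => ovlp N ρ.1 ρ.2 ^ 2) ∂disM3 N := by
        simp [hsymm]
    _ = ∫ ω, ((N - 2 : ℝ) * gibbsT N β t ω.1 ω.2.1 ω.2.2 (fun ρ => ovlp N ρ.1 ρ.2 ^ 2) ^ 2 +
          1 / (N : ℝ) * gibbsT N β t ω.1 ω.2.1 ω.2.2 (fun ρ => ovlp N ρ.1 ρ.2 ^ 2))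
            ∂disM3 N := by
        rw [← integral_finsetSum _ fun l _ => integrable_gibbsT_mul β t _ _]
        refine integral_congr_ae (.of_forall fun ω => ?_)
        simp only [← Finset.sum_mul, ← gibbsT_sum, sum_ovlpDel_sq hN, gibbsT_add,
          gibbsT_const_mul, gibbsT_const]
        ring
    _ = _ := by
        rw [integral_add (hsq.const_mul _) ((integrable_gibbsT β t _).const_mul _),
          integral_const_mul, integral_const_mul]

end CoupledGibbs

/-- `E⟨R(σ¹,τ¹)²R(σ²,τ²)²⟩_t − E⟨R⁻(σ¹,τ¹)²R(σ²,τ²)²⟩_t ≥ 0`. -/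
theorem sk_fourth_moment_truncation_nonneg (N : ℕ) (hN : 1 ≤ N) (β : ℝ) (hβ : 0 < β)
    (t : ℝ) (ht : t ∈ Set.Icc (0 : ℝ) 1) :
    0 ≤ EgibbsT2 N β t (fun ρ₁ ρ₂ => ovlp N ρ₁.1 ρ₁.2 ^ 2 * ovlp N ρ₂.1 ρ₂.2 ^ 2) -
        EgibbsT2 N β t (fun ρ₁ ρ₂ => ovlpm N ρ₁.1 ρ₁.2 ^ 2 * ovlp N ρ₂.1 ρ₂.2 ^ 2) := by
  have hN0 : (0 : ℝ) < N := by exact_mod_cast hN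
  set X := fun ω : (Fin N × Fin N → ℝ) × (Fin N × Fin N → ℝ) × (Fin N × Fin N → ℝ) =>
    gibbsT N β t ω.1 ω.2.1 ω.2.2 (fun ρ => ovlp N ρ.1 ρ.2 ^ 2)
  have hXm : MemLp X 2 (disM3 N) :=
    .of_bound (measurable_gibbsT β t _).aestronglyMeasurable _
      (.of_forall fun ω => abs_gibbsT_le β t ω.1 ω.2.1 ω.2.2 _)
  have hvar : (∫ ω, X ω ∂disM3 N) ^ 2 ≤ ∫ ω, X ω ^ 2 ∂disM3 N := by
    have h := variance_nonneg X (disM3 N)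
    rw [variance_eq_sub hXm] at h
    simpa using h
  have hmean : 1 / (N : ℝ) ≤ ∫ ω, X ω ∂disM3 N := one_div_le_integral_gibbsT_ovlp_sq hN β t
  have hdel := integral_gibbsT_ovlpDel_sq hN β t ⟨N - 1, Nat.sub_lt hN Nat.one_pos⟩
  simp only [EgibbsT2, ovlpm_eq_ovlpDel hN]
  simp only [gibbsT2_mul β t _ _ _ (fun ρ => ovlp N ρ.1 ρ.2 ^ 2),
    gibbsT2_mul β t _ _ _ (fun ρ => ovlpDel N _ ρ.1 ρ.2 ^ 2), ← pow_two (gibbsT _ _ _ _ _ _ _)]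
  change _ = (N - 2 : ℝ) * ∫ ω, X ω ^ 2 ∂disM3 N + 1 / (N : ℝ) * ∫ ω, X ω ∂disM3 N at hdel
  set A := ∫ ω, X ω ^ 2 ∂disM3 N
  set m := ∫ ω, X ω ∂disM3 N
  have hm0 : 0 ≤ m := (by positivity : (0 : ℝ) ≤ 1 / N).trans hmean
  refine nonneg_of_mul_nonneg_right (a := (N : ℝ)) ?_ hN0
  rw [mul_sub, hdel]
  nlinarith [mul_le_mul_of_nonneg_right hmean hm0]

end
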